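/- Fix 1 ≤ δ ≤ 16. For a quartic surface S = X ∩ H ⊂ ℙ³ with exactly δ nodes and node set Δ = Sing S, the space of quartic forms vanishing at Δ satisfies dim H⁰(I_{ℙ³,Δ}(4)) = 35 − δ; equivalently, the δ evaluation conditions at the nodes are linearly independent on the 35-dimensional space H⁰(O_{ℙ³}(4)). -/

import Mathlib

open Module MvPolynomial

namespace NodalQuartic

variable {σ : Type*}

lemma eval_smul [Fintype σ] {g : MvPolynomial σ ℂ} {d : ℕ} (hg : g.IsHomogeneous d) (c : ℂ)
    (x : σ → ℂ) : eval (c • x) g = c ^ d * eval x g := by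
  rw [eval_eq', eval_eq', Finset.mul_sum]
  refine Finset.sum_congr rfl fun m hm => ?_
  have hdeg : ∑ i, m i = d := by
    rw [hg.degree_eq_sum_deg_support hm, ← Finsupp.degree_eq_sum, Finsupp.degree_apply]
  simp only [Pi.smul_apply, smul_eq_mul, mul_pow, Finset.prod_mul_distrib,
    Finset.prod_pow_eq_pow_sum, hdeg]
  ring

lemma homogeneousComponent_mul_left {n g : MvPolynomial σ ℂ} {d : ℕ} (hn : n.IsHomogeneous d)
    (k : ℕ) : homogeneousComponent (d + k) (n * g) = n * homogeneousComponent k g := by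
  conv_lhs => rw [← sum_homogeneousComponent g, Finset.mul_sum, map_sum]
  have key (i : ℕ) : homogeneousComponent (d + k) (n * homogeneousComponent i g) =
      if i = k then n * homogeneousComponent i g else 0 := by
    have h := hn.mul (homogeneousComponent_isHomogeneous i g)
    rw [homogeneousComponent_of_mem h]
    simp [eq_comm]
  simp only [key, Finset.sum_ite_eq', Finset.mem_range]
  split_ifs with h
  · rfl
  · rw [homogeneousComponent_eq_zero _ _ (by omega), mul_zero]

/-- The functional `m ↦ φ (g * m)`. -/
noncomputable def contract (φ : MvPolynomial σ ℂ →ₗ[ℂ] ℂ) (g : MvPolynomial σ ℂ) :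
    MvPolynomial σ ℂ →ₗ[ℂ] ℂ :=
  φ ∘ₗ LinearMap.mulLeft ℂ g

@[simp]
lemma contract_apply (φ : MvPolynomial σ ℂ →ₗ[ℂ] ℂ) (g m : MvPolynomial σ ℂ) :
    contract φ g m = φ (g * m) := rfl

/-- `φ` only sees the homogeneous component of degree `d`. -/
def ConcentratedIn (φ : MvPolynomial σ ℂ →ₗ[ℂ] ℂ) (d : ℕ) : Prop :=
  ∀ (e : ℕ) (g : MvPolynomial σ ℂ), g.IsHomogeneous e → e ≠ d → φ g = 0

/-- `φ` kills every polynomial vanishing on `K`. -/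
def SupportedOn (φ : MvPolynomial σ ℂ →ₗ[ℂ] ℂ) (K : Submodule ℂ (σ → ℂ)) : Prop :=
  ∀ g : MvPolynomial σ ℂ, (∀ x ∈ K, eval x g = 0) → φ g = 0

/-- The forms of degree at most `3` annihilating `φ` have no common zero in projective space. -/
def CubicsBasePointFree (φ : MvPolynomial σ ℂ →ₗ[ℂ] ℂ) : Prop :=
  ∀ u : σ → ℂ, u ≠ 0 → ∃ e ≤ 3, ∃ g : MvPolynomial σ ℂ,
    g.IsHomogeneous e ∧ contract φ g = 0 ∧ eval u g ≠ 0

variable {φ : MvPolynomial σ ℂ →ₗ[ℂ] ℂ}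

lemma contract_mul (g h : MvPolynomial σ ℂ) : contract (contract φ g) h = contract φ (g * h) := by
  exact LinearMap.ext fun m => by simp [mul_assoc]

lemma contract_comm (g h : MvPolynomial σ ℂ) :
    contract (contract φ g) h = contract (contract φ h) g := by
  rw [contract_mul, contract_mul, mul_comm]

lemma ConcentratedIn.contract {d k : ℕ} (hφ : ConcentratedIn φ (k + d)) {g : MvPolynomial σ ℂ}
    (hg : g.IsHomogeneous k) : ConcentratedIn (contract φ g) d :=
  fun e m hm he => hφ (k + e) _ (hg.mul hm) (by omega)

lemma ConcentratedIn.eq_zero {d : ℕ} (hφ : ConcentratedIn φ d)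
    (h : ∀ g : MvPolynomial σ ℂ, g.IsHomogeneous d → φ g = 0) : φ = 0 := by
  refine LinearMap.ext fun g => ?_
  rw [← sum_homogeneousComponent g, map_sum, LinearMap.zero_apply]
  refine Finset.sum_eq_zero fun i _ => ?_
  by_cases hi : i = d
  · exact h _ (hi ▸ homogeneousComponent_isHomogeneous i g)
  · exact hφ i _ (homogeneousComponent_isHomogeneous i g) hi

lemma CubicsBasePointFree.contract (hφ : CubicsBasePointFree φ) (g : MvPolynomial σ ℂ) :
    CubicsBasePointFree (contract φ g) := fun u hu => by
  obtain ⟨e, he, h, hh, h0, hu⟩ := hφ u hu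
  exact ⟨e, he, h, hh, by rw [contract_comm, h0]; rfl, hu⟩

variable {K : Submodule ℂ (σ → ℂ)}

lemma SupportedOn.contract (hφ : SupportedOn φ K) (g : MvPolynomial σ ℂ) :
    SupportedOn (contract φ g) K :=
  fun h hh => hφ _ fun x hx => by simp [hh x hx]

lemma SupportedOn.contract_congr (hφ : SupportedOn φ K) {g h : MvPolynomial σ ℂ}
    (hgh : ∀ x ∈ K, eval x g = eval x h) :
    NodalQuartic.contract φ g = NodalQuartic.contract φ h := by
  refine LinearMap.ext fun m => ?_
  rw [← sub_eq_zero, contract_apply, contract_apply, ← map_sub, ← sub_mul]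
  exact hφ _ fun x hx => by simp [hgh x hx]

lemma supportedOn_top (φ : MvPolynomial σ ℂ →ₗ[ℂ] ℂ) : SupportedOn φ ⊤ := fun g hg => by
  have h : g = 0 := MvPolynomial.funext fun x => by simpa using hg x trivial
  rw [h, map_zero]

lemma exists_polynomial_eval_eq (g : MvPolynomial σ ℂ) (a b : σ → ℂ) :
    ∃ p : Polynomial ℂ, ∀ t, p.eval t = eval (a + t • b) g := by
  refine ⟨aeval (fun i => Polynomial.C (a i) + Polynomial.X * Polynomial.C (b i)) g, fun t => ?_⟩
  rw [← Polynomial.coe_aeval_eq_eval, ← AlgHom.comp_apply, comp_aeval, ← aeval_eq_eval]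
  congr 2
  ext i
  simp
  ring

section PointFunctional

variable {ι : Type*} [Fintype ι]

/-- The functional `g ↦ ∑ c i * g (P i)` on forms of degree `d`, extended by zero. -/
noncomputable def pointFunctional (c : ι → ℂ) (P : ι → σ → ℂ) (d : ℕ) :
    MvPolynomial σ ℂ →ₗ[ℂ] ℂ :=
  ∑ i, c i • ((aeval (P i)).toLinearMap ∘ₗ homogeneousComponent d)

variable {c : ι → ℂ} {P : ι → σ → ℂ} {d : ℕ}

lemma pointFunctional_apply {g : MvPolynomial σ ℂ} (hg : g.IsHomogeneous d) :
    pointFunctional c P d g = ∑ i, c i * eval (P i) g := by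
  simp [pointFunctional, homogeneousComponent_eq_self hg, aeval_eq_eval]

lemma concentratedIn_pointFunctional : ConcentratedIn (pointFunctional c P d) d :=
  fun e g hg he => by simp [pointFunctional, homogeneousComponent_of_mem hg, he.symm]

lemma contract_pointFunctional_eq_zero {k : ℕ} {g : MvPolynomial σ ℂ} (hg : g.IsHomogeneous k)
    (hkd : k ≤ d) (h : ∀ i, c i * eval (P i) g = 0) : contract (pointFunctional c P d) g = 0 := by
  obtain ⟨d, rfl⟩ := Nat.exists_eq_add_of_le hkd
  refine (concentratedIn_pointFunctional.contract hg).eq_zero fun m hm => ?_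
  rw [contract_apply, pointFunctional_apply (hg.mul hm)]
  exact Finset.sum_eq_zero fun i _ => by rw [map_mul, ← mul_assoc, h, zero_mul]

end PointFunctional

variable [Fintype σ]

/-- The linear form on `ℂ^σ` attached to a functional, as a polynomial. -/
noncomputable def linearForm (f : Dual ℂ (σ → ℂ)) : MvPolynomial σ ℂ :=
  ∑ i, C (f (Pi.basisFun ℂ σ i)) * X i

@[simp]
lemma eval_linearForm (f : Dual ℂ (σ → ℂ)) (x : σ → ℂ) : eval x (linearForm f) = f x := by
  conv_rhs => rw [← (Pi.basisFun ℂ σ).sum_repr x, map_sum]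
  simp [linearForm, mul_comm]

lemma isHomogeneous_linearForm (f : Dual ℂ (σ → ℂ)) : (linearForm f).IsHomogeneous 1 :=
  IsHomogeneous.sum _ _ _ fun i _ => isHomogeneous_C_mul_X _ i

lemma linearForm_dvd_sub (g : MvPolynomial σ ℂ) (n : Dual ℂ (σ → ℂ)) (e : σ → ℂ) :
    linearForm n ∣ g - aeval (fun i => X i - C (e i) * linearForm n) g := by
  rw [← Ideal.mem_span_singleton, ← Ideal.Quotient.eq]
  set I := Ideal.span {linearForm n}
  have hn : Ideal.Quotient.mk I (linearForm n) = 0 :=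
    Ideal.Quotient.eq_zero_iff_mem.2 (Ideal.mem_span_singleton_self _)
  have : (Ideal.Quotient.mk I).comp
      (aeval (R := ℂ) (fun i => X i - C (e i) * linearForm n)).toRingHom =
      Ideal.Quotient.mk I := by
    ext i <;> simp [hn]
  exact (RingHom.congr_fun this g).symm

lemma eval_aeval_sub (g : MvPolynomial σ ℂ) (n : Dual ℂ (σ → ℂ)) (e x : σ → ℂ) :
    eval x (aeval (fun i => X i - C (e i) * linearForm n) g) = eval (x - n x • e) g := by
  rw [← aeval_eq_eval, ← AlgHom.comp_apply, comp_aeval, aeval_eq_eval]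
  congr 2
  ext i
  simp [aeval_eq_eval, mul_comm]

lemma exists_eval_sub_eq_mul (g : MvPolynomial σ ℂ) (n : Dual ℂ (σ → ℂ)) (e : σ → ℂ) :
    ∃ q : MvPolynomial σ ℂ, ∀ x, eval x g - eval (x - n x • e) g = n x * eval x q := by
  obtain ⟨q, hq⟩ := linearForm_dvd_sub g n e
  refine ⟨q, fun x => ?_⟩
  have h := congrArg (eval x) hq
  rwa [map_sub, eval_aeval_sub, map_mul, eval_linearForm] at h

lemma exists_isHomogeneous_eval_sub_eq_mul {g : MvPolynomial σ ℂ} {k : ℕ}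
    (hg : g.IsHomogeneous (k + 1)) (n : Dual ℂ (σ → ℂ)) (e : σ → ℂ) :
    ∃ q : MvPolynomial σ ℂ, q.IsHomogeneous k ∧
      ∀ x, eval x g - eval (x - n x • e) g = n x * eval x q := by
  obtain ⟨q, hq⟩ := linearForm_dvd_sub g n e
  refine ⟨homogeneousComponent k q, homogeneousComponent_isHomogeneous _ _, fun x => ?_⟩
  have hP : (aeval (fun i => X i - C (e i) * linearForm n) g).IsHomogeneous (k + 1) := by
    have := hg.aeval (R := ℂ) (S := ℂ) (fun i => X i - C (e i) * linearForm n) (n := 1)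
      fun i => (isHomogeneous_X _ i).sub ((isHomogeneous_linearForm n).C_mul _)
    simpa using this
  have h := homogeneousComponent_mul_left (g := q) (isHomogeneous_linearForm n) k
  rw [← hq, add_comm 1 k, homogeneousComponent_eq_self (hg.sub hP)] at h
  have h := congrArg (eval x) h
  rwa [map_sub, eval_aeval_sub, map_mul, eval_linearForm] at h

/-- A form that vanishes on the hyperplane section `K ∩ {n = 0}` is divisible by `n` on `K`. -/
lemma exists_eval_eq_mul {g : MvPolynomial σ ℂ} {k : ℕ} (hg : g.IsHomogeneous (k + 1))
    {K : Submodule ℂ (σ → ℂ)} {n : Dual ℂ (σ → ℂ)} {e : σ → ℂ} (he : e ∈ K) (hne : n e ≠ 0)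
    (hgK : ∀ x ∈ K ⊓ LinearMap.ker n, eval x g = 0) :
    ∃ q : MvPolynomial σ ℂ, q.IsHomogeneous k ∧ ∀ x ∈ K, eval x g = n x * eval x q := by
  obtain ⟨q, hq, h⟩ := exists_isHomogeneous_eval_sub_eq_mul hg n ((n e)⁻¹ • e)
  refine ⟨q, hq, fun x hx => ?_⟩
  rw [← h x, hgK _ ⟨K.sub_mem hx (K.smul_mem _ (K.smul_mem _ he)), ?_⟩, sub_zero]
  simp [hne]

lemma SupportedOn.inf_ker (hφ : SupportedOn φ K) {n : Dual ℂ (σ → ℂ)}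
    (hn : NodalQuartic.contract φ (linearForm n) = 0) : SupportedOn φ (K ⊓ LinearMap.ker n) := by
  intro g hg
  by_cases hK : ∃ e ∈ K, n e ≠ 0
  · obtain ⟨e, he, hne⟩ := hK
    obtain ⟨q, hq⟩ := exists_eval_sub_eq_mul g n ((n e)⁻¹ • e)
    have h : φ (g - linearForm n * q) = 0 := hφ _ fun x hx => by
      have hx0 := hg (x - n x • (n e)⁻¹ • e)
        ⟨K.sub_mem hx (K.smul_mem _ (K.smul_mem _ he)), by simp [hne]⟩
      simp [← hq x, hx0]
    rw [map_sub, ← contract_apply, hn] at h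
    simpa using h
  · push Not at hK
    exact hφ g fun x hx => hg x ⟨hx, hK x hx⟩

lemma finrank_inf_ker_lt {e : σ → ℂ} (he : e ∈ K) {n : Dual ℂ (σ → ℂ)} (hne : n e ≠ 0) :
    finrank ℂ ↥(K ⊓ LinearMap.ker n) < finrank ℂ K :=
  Submodule.finrank_lt_finrank_of_lt <| inf_le_left.lt_of_ne fun h => hne
    (inf_eq_left.1 h he)

/-- A functional supported on a point at which some cubic annihilating it does not vanish is
zero. -/
lemma eq_zero_of_finrank_le_one {d : ℕ} (hd : 3 ≤ d) (hφ : ConcentratedIn φ d)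
    (hb : CubicsBasePointFree φ) (hK : SupportedOn φ K) (hr : finrank ℂ K ≤ 1) : φ = 0 := by
  obtain ⟨⟨u, huK⟩, hu⟩ := finrank_le_one_iff.1 hr
  by_cases hu0 : u = 0
  · refine hφ.eq_zero fun g hg => hK g fun x hx => ?_
    obtain ⟨c, hc⟩ := hu ⟨x, hx⟩
    have : x = (0 : ℂ) • x := by
      have := congrArg Subtype.val hc
      simp [hu0] at this
      simp [← this]
    rw [this, eval_smul hg, zero_pow (by omega), zero_mul]
  obtain ⟨e, he, g, hg, hg0, hgu⟩ := hb u hu0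
  obtain ⟨v, hv⟩ := Module.exists_dual_forall_apply_ne_zero (K := ℂ) (fun _ : Unit => u)
    fun _ => hu0
  have hv := hv ()
  refine hφ.eq_zero fun h hh => ?_
  set q := C (eval u h / (eval u g * v u ^ (d - e))) * linearForm v ^ (d - e)
  have key : φ (h - g * q) = 0 := hK _ fun x hx => by
    obtain ⟨c, hc⟩ := hu ⟨x, hx⟩
    obtain rfl : c • u = x := congrArg Subtype.val hc
    have hpow : c ^ d = c ^ e * c ^ (d - e) := by rw [← pow_add]; congr 1; omega
    simp only [q, map_sub, map_mul, map_pow, eval_smul hh, eval_smul hg, eval_C, eval_linearForm,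
      map_smul, smul_eq_mul, mul_pow, hpow]
    field_simp
    ring
  rw [map_sub, ← contract_apply, hg0] at key
  simpa using key

/-- A form of positive degree has a nontrivial zero on every line of projective space. -/
lemma exists_mem_eval_eq_zero {g : MvPolynomial σ ℂ} {k : ℕ} (hg : g.IsHomogeneous (k + 1))
    (hr : 2 ≤ finrank ℂ K) : ∃ w ∈ K, w ≠ 0 ∧ eval w g = 0 := by
  obtain ⟨e, he⟩ : ∃ e : K, e ≠ 0 := by
    have : Nontrivial K := Module.nontrivial_of_finrank_pos (R := ℂ) (by omega)
    exact exists_ne 0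
  obtain ⟨w, hw⟩ : ∃ w : K, w ∉ Submodule.span ℂ {e} := by
    by_contra! h
    have h1 := finrank_le_one (R := ℂ) e fun w => Submodule.mem_span_singleton.1 (h w)
    omega
  obtain ⟨p, hp⟩ := exists_polynomial_eval_eq g w.1 e.1
  by_cases hdeg : p.degree = 0
  · refine ⟨e, e.2, by simpa using he, ?_⟩
    obtain ⟨c, rfl⟩ : ∃ c, p = Polynomial.C c := ⟨_, Polynomial.eq_C_of_degree_eq_zero hdeg⟩
    obtain ⟨q, hq⟩ := exists_polynomial_eval_eq g e.1 w.1
    have h : Polynomial.X * (q - Polynomial.X ^ (k + 1) * Polynomial.C c) = 0 := by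
      refine Polynomial.funext fun s => ?_
      by_cases hs : s = 0
      · simp [hs]
      have h1 : e.1 + s • w.1 = s • (w.1 + s⁻¹ • e.1) := by
        rw [smul_add, smul_smul, mul_inv_cancel₀ hs, one_smul, add_comm]
      have h2 := hp s⁻¹
      simp only [Polynomial.eval_C] at h2
      rw [Polynomial.eval_mul, Polynomial.eval_sub, hq, h1, eval_smul hg, ← h2]
      simp only [Polynomial.eval_mul, Polynomial.eval_pow, Polynomial.eval_X, Polynomial.eval_C,
        sub_self, mul_zero, Polynomial.eval_zero]
    have h := (mul_eq_zero.1 h).resolve_left Polynomial.X_ne_zero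
    have h := congrArg (Polynomial.eval 0) h
    simpa [hq] using h
  · obtain ⟨t, ht⟩ := IsAlgClosed.exists_root p hdeg
    refine ⟨w + t • e, (w + t • e).2, fun h => hw ?_, by rw [← hp]; exact ht⟩
    have : w = (-t) • e := by
      rw [neg_smul t e, eq_neg_iff_add_eq_zero]; exact Subtype.ext h
    exact Submodule.mem_span_singleton.2 ⟨-t, this.symm⟩

/-- A functional of degree `d ≥ k + 2` supported on a line and annihilated by a form of degree `k`
that does not vanish identically on this line is zero. -/
lemma eq_zero_of_finrank_le_two_of_contract_eq_zero {k d : ℕ} (hd : k + 2 ≤ d)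
    (hφ : ConcentratedIn φ d) (hb : CubicsBasePointFree φ) (hK : SupportedOn φ K)
    (hr : finrank ℂ K ≤ 2) {g : MvPolynomial σ ℂ} (hg : g.IsHomogeneous k)
    (hg0 : contract φ g = 0) {x : σ → ℂ} (hx : x ∈ K) (hgx : eval x g ≠ 0) : φ = 0 := by
  induction k generalizing φ d g x with
  | zero =>
    obtain ⟨c, rfl⟩ : ∃ c, g = C c :=
      ⟨_, totalDegree_eq_zero_iff_eq_C.1 ((totalDegree_zero_iff_isHomogeneous σ).2 hg)⟩
    rw [eval_C] at hgx
    refine LinearMap.ext fun m => ?_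
    have h := LinearMap.congr_fun hg0 m
    rw [contract_apply, ← smul_eq_C_mul, map_smul, smul_eq_mul] at h
    exact (mul_eq_zero.1 h).resolve_left hgx
  | succ k ih =>
    rcases Nat.lt_or_ge (finrank ℂ K) 2 with hr1 | hr2
    · exact eq_zero_of_finrank_le_one (by omega) hφ hb hK (by omega)
    obtain ⟨w, hw, hw0, hgw⟩ := exists_mem_eval_eq_zero hg hr2
    obtain ⟨e, he, hew⟩ : ∃ e ∈ K, e ∉ Submodule.span ℂ {w} := by
      by_contra! h
      have h1 := Submodule.finrank_mono (show K ≤ Submodule.span ℂ {w} from h)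
      rw [finrank_span_singleton hw0] at h1
      omega
    obtain ⟨n, hne, hn⟩ := Submodule.exists_le_ker_of_notMem hew
    have hlt := finrank_inf_ker_lt he hne
    have hker : Submodule.span ℂ {w} = K ⊓ LinearMap.ker n := by
      refine Submodule.eq_of_le_of_finrank_le (le_inf (by simpa using hw) hn) ?_
      rw [finrank_span_singleton hw0]
      omega
    obtain ⟨q, hq, hgq⟩ := exists_eval_eq_mul hg he hne fun y hy => by
      rw [← hker] at hy
      obtain ⟨c, rfl⟩ := Submodule.mem_span_singleton.1 hy
      rw [eval_smul hg, hgw, mul_zero]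
    obtain ⟨d, rfl⟩ := Nat.exists_eq_add_of_le (show 1 ≤ d by omega)
    have hzero : contract φ (linearForm n) = 0 := by
      refine ih (by omega) (hφ.contract (isHomogeneous_linearForm n)) (hb.contract _)
        (hK.contract _) hq ?_ hx fun h => hgx (by rw [hgq x hx, h, mul_zero])
      rw [contract_mul, ← hK.contract_congr (g := g) fun y hy => by simp [hgq y hy], hg0]
    exact eq_zero_of_finrank_le_one (by omega) hφ hb (hK.inf_ker hzero) (by omega)

/-- A functional of degree at least `5` supported on a line is zero. -/
lemma eq_zero_of_finrank_le_two {d : ℕ} (hd : 5 ≤ d) (hφ : ConcentratedIn φ d)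
    (hb : CubicsBasePointFree φ) (hK : SupportedOn φ K) (hr : finrank ℂ K ≤ 2) : φ = 0 := by
  rcases Nat.lt_or_ge (finrank ℂ K) 1 with hr1 | hr1
  · exact eq_zero_of_finrank_le_one (by omega) hφ hb hK (by omega)
  obtain ⟨u, hu⟩ : ∃ u : K, u ≠ 0 := by
    have : Nontrivial K := Module.nontrivial_of_finrank_pos (R := ℂ) (by omega)
    exact exists_ne 0
  obtain ⟨e, he, g, hg, hg0, hgu⟩ := hb u (by simpa using hu)
  exact eq_zero_of_finrank_le_two_of_contract_eq_zero (by omega) hφ hb hK hr hg hg0 u.2 hgu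

lemma exists_sum_X_mul {g : MvPolynomial σ ℂ} {k : ℕ} (hg : g.IsHomogeneous (k + 1)) :
    ∃ p : σ → MvPolynomial σ ℂ, (∀ i, (p i).IsHomogeneous k) ∧ g = ∑ i, X i * p i := by
  refine ⟨fun i => C ((k + 1 : ℂ)⁻¹) * pderiv i g, fun i => (hg.pderiv).C_mul _, ?_⟩
  have h := hg.sum_X_mul_pderiv
  have hk : (k + 1 : ℂ) ≠ 0 := by exact_mod_cast k.succ_ne_zero
  calc g = C ((k + 1 : ℂ)⁻¹) * ((k + 1) • g) := by
        rw [← Nat.cast_smul_eq_nsmul ℂ, smul_eq_C_mul, ← mul_assoc, ← C_mul, Nat.cast_add_one,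
          inv_mul_cancel₀ hk, C_1, one_mul]
    _ = _ := by
        rw [← h, Finset.mul_sum]
        exact Finset.sum_congr rfl fun i _ => by ring

lemma exists_eq_linearForm {g : MvPolynomial σ ℂ} (hg : g.IsHomogeneous 1) :
    ∃ f : Dual ℂ (σ → ℂ), g = linearForm f := by
  obtain ⟨p, hp, h⟩ := exists_sum_X_mul hg
  have hc (i : σ) : ∃ c, p i = C c :=
    ⟨_, totalDegree_eq_zero_iff_eq_C.1 ((totalDegree_zero_iff_isHomogeneous σ).2 (hp i))⟩
  choose c hc using hc
  refine ⟨∑ i, c i • LinearMap.proj i, MvPolynomial.funext fun x => ?_⟩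
  simp [h, hc, mul_comm]

lemma exists_bilinForm_eval_eq {g : MvPolynomial σ ℂ} (hg : g.IsHomogeneous 2) :
    ∃ B : LinearMap.BilinForm ℂ (σ → ℂ), B.IsSymm ∧ ∀ x, eval x g = B x x := by
  obtain ⟨p, hp, h⟩ := exists_sum_X_mul hg
  choose f hf using fun i => exists_eq_linearForm (hp i)
  set A : LinearMap.BilinForm ℂ (σ → ℂ) :=
    ∑ i, (LinearMap.proj (R := ℂ) (φ := fun _ : σ => ℂ) i).smulRight (f i)
  refine ⟨(2⁻¹ : ℂ) • (A + A.flip), ⟨fun x y => by simp [add_comm]⟩, fun x => ?_⟩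
  have hA : A x x = eval x g := by simp [A, h, hf]
  simp [hA]
  ring

/-- A pencil of quadratic forms on a three-dimensional space has a member that vanishes on a
plane. -/
lemma exists_pencil_member_eq_zero_on_plane (hr : finrank ℂ K = 3) {q₁ q₂ : MvPolynomial σ ℂ}
    (h₁ : q₁.IsHomogeneous 2) (h₂ : q₂.IsHomogeneous 2) :
    ∃ s t : ℂ, (s, t) ≠ 0 ∧ ∃ n : Dual ℂ (σ → ℂ), (∃ e ∈ K, n e ≠ 0) ∧
      ∀ x ∈ K ⊓ LinearMap.ker n, eval x (C s * q₁ + C t * q₂) = 0 := by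
  obtain ⟨B₁, hs₁, hB₁⟩ := exists_bilinForm_eval_eq h₁
  obtain ⟨B₂, hs₂, hB₂⟩ := exists_bilinForm_eval_eq h₂
  set A₁ : K →ₗ[ℂ] Dual ℂ K := B₁.domRestrict₁₂ K K
  set A₂ : K →ₗ[ℂ] Dual ℂ K := B₂.domRestrict₁₂ K K
  obtain ⟨s, t, hst, w, hw0, hw⟩ : ∃ s t : ℂ, (s, t) ≠ 0 ∧ ∃ w : K, w ≠ 0 ∧
      s • A₁ w + t • A₂ w = 0 := by
    by_cases hinj : Function.Injective A₂
    · set T := LinearEquiv.ofInjectiveOfFinrankEq A₂ hinj (Subspace.dual_finrank_eq).symm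
      have : Nontrivial K := Module.nontrivial_of_finrank_pos (R := ℂ) (by omega)
      obtain ⟨μ, hμ⟩ := Module.End.exists_eigenvalue (T.symm.toLinearMap ∘ₗ A₁)
      obtain ⟨w, hw⟩ := hμ.exists_hasEigenvector
      refine ⟨1, -μ, by simp, w, hw.2, ?_⟩
      have h := congrArg T hw.apply_eq_smul
      have hT : T w = A₂ w := rfl
      simp only [LinearMap.comp_apply, LinearEquiv.coe_coe, LinearEquiv.apply_symm_apply,
        map_smul, hT] at h
      simp [h]
    · rw [← LinearMap.ker_eq_bot, Submodule.eq_bot_iff] at hinj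
      push Not at hinj
      obtain ⟨w, hw, hw0⟩ := hinj
      exact ⟨0, 1, by simp, w, hw0, by simpa using hw⟩
  refine ⟨s, t, hst, ?_⟩
  set q := C s * q₁ + C t * q₂
  have hq : q.IsHomogeneous 2 := (h₁.C_mul s).add (h₂.C_mul t)
  have hwB (y : σ → ℂ) (hy : y ∈ K) : s * B₁ w y + t * B₂ w y = 0 := by
    exact LinearMap.congr_fun hw ⟨y, hy⟩
  have hvertex (c : ℂ) (y : σ → ℂ) (hy : y ∈ K) : eval (c • (w : σ → ℂ) + y) q = eval y q := by
    have e₁ : B₁ y w = B₁ w y := (hs₁.eq w y).symm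
    have e₂ : B₂ y w = B₂ w y := (hs₂.eq w y).symm
    simp only [q, map_add, map_mul, eval_C, hB₁, hB₂, map_smul, LinearMap.add_apply,
      LinearMap.smul_apply, smul_eq_mul, e₁, e₂]
    linear_combination c ^ 2 * hwB w w.2 + 2 * c * hwB y hy
  obtain ⟨m, hmw, -⟩ := Submodule.exists_le_ker_of_notMem
    (show (w : σ → ℂ) ∉ (⊥ : Submodule ℂ (σ → ℂ)) by simpa using hw0)
  have hge : finrank ℂ K ≤ finrank ℂ ↥(K ⊓ LinearMap.ker m) + 1 := by
    have h := Module.Dual.finrank_ker_add_one_of_ne_zero (f := m.domRestrict K) fun h =>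
      hmw (LinearMap.congr_fun h w)
    rw [← h, ← Submodule.map_comap_subtype, Submodule.finrank_map_subtype_eq]
    rfl
  obtain ⟨z, hz, hz0, hqz⟩ := exists_mem_eval_eq_zero (K := K ⊓ LinearMap.ker m) hq (by omega)
  have hzw : LinearIndependent ℂ ![(w : σ → ℂ), z] := by
    rw [LinearIndependent.pair_iff]
    intro a b hab
    have h := congrArg m hab
    rw [map_add, map_smul, map_smul, show m z = 0 from hz.2] at h
    have ha : a = 0 := by simpa [hmw] using h
    refine ⟨ha, ?_⟩
    simpa [ha, hz0] using hab
  set P := Submodule.span ℂ (Set.range ![(w : σ → ℂ), z])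
  have hP : finrank ℂ P = 2 := by simpa using finrank_span_eq_card hzw
  have hPK : P ≤ K := by
    rw [Submodule.span_le]
    rintro _ ⟨i, rfl⟩
    fin_cases i
    · exact w.2
    · exact hz.1
  obtain ⟨e, he, heP⟩ : ∃ e ∈ K, e ∉ P := by
    by_contra! h
    have := Submodule.finrank_mono (show K ≤ P from h)
    omega
  obtain ⟨n, hne, hn⟩ := Submodule.exists_le_ker_of_notMem heP
  refine ⟨n, ⟨e, he, hne⟩, fun x hx => ?_⟩
  have hlt := finrank_inf_ker_lt he hne
  have hPn : P = K ⊓ LinearMap.ker n :=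
    Submodule.eq_of_le_of_finrank_le (le_inf hPK hn) (by omega)
  rw [← hPn] at hx
  obtain ⟨a, b, rfl⟩ : ∃ a b : ℂ, a • (w : σ → ℂ) + b • z = x := by
    rw [← Submodule.mem_span_pair]
    simpa only [P, Matrix.range_cons, Matrix.range_empty, Set.union_empty,
      Set.singleton_union] using hx
  rw [hvertex a _ (K.smul_mem b hz.1), eval_smul hq, hqz, mul_zero]

/-- A functional of degree `5` supported on a plane and annihilated by two quadratic forms that
are independent on this plane is zero. -/
lemma eq_zero_of_finrank_le_three (hφ : ConcentratedIn φ 5) (hb : CubicsBasePointFree φ)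
    (hK : SupportedOn φ K) (hr : finrank ℂ K ≤ 3) {q₁ q₂ : MvPolynomial σ ℂ}
    (h₁ : q₁.IsHomogeneous 2) (h₂ : q₂.IsHomogeneous 2)
    (h₁0 : contract φ q₁ = 0) (h₂0 : contract φ q₂ = 0)
    (hind : ∀ s t : ℂ, (∀ x ∈ K, eval x (C s * q₁ + C t * q₂) = 0) → s = 0 ∧ t = 0) : φ = 0 := by
  rcases Nat.lt_or_ge (finrank ℂ K) 3 with hr2 | hr3
  · exact eq_zero_of_finrank_le_two le_rfl hφ hb hK (by omega)
  have hcontract (s t : ℂ) : contract φ (C s * q₁ + C t * q₂) = 0 := by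
    refine LinearMap.ext fun m => ?_
    have e₁ : φ (q₁ * m) = 0 := LinearMap.congr_fun h₁0 m
    have e₂ : φ (q₂ * m) = 0 := LinearMap.congr_fun h₂0 m
    simp [add_mul, ← smul_eq_C_mul, e₁, e₂]
  obtain ⟨s, t, hst, n, ⟨e, he, hne⟩, hn⟩ :=
    exists_pencil_member_eq_zero_on_plane (hr.antisymm hr3) h₁ h₂
  obtain ⟨s', t', hst'⟩ : ∃ s' t' : ℂ, s * t' - t * s' ≠ 0 := by
    by_cases hs : s = 0
    · exact ⟨1, 0, by simpa [hs] using hst⟩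
    · exact ⟨0, 1, by simpa using hs⟩
  have hpencil (s t : ℂ) : (C s * q₁ + C t * q₂).IsHomogeneous 2 := (h₁.C_mul s).add (h₂.C_mul t)
  obtain ⟨m, hm, hqm⟩ := exists_eval_eq_mul (hpencil s t) he hne hn
  obtain ⟨m, rfl⟩ := exists_eq_linearForm hm
  simp only [eval_linearForm] at hqm
  have hnm : contract φ (linearForm n * linearForm m) = 0 := by
    rw [← hK.contract_congr (g := C s * q₁ + C t * q₂) fun x hx => by simp [← hqm x hx],
      hcontract]
  obtain ⟨y, hy, hmy⟩ : ∃ y ∈ K, m y ≠ 0 := by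
    by_contra! h
    have := hind s t fun x hx => by rw [hqm x hx, h x hx, mul_zero]
    exact hst (by simp [this])
  have hKn := finrank_inf_ker_lt he hne
  have hKm := finrank_inf_ker_lt hy hmy
  have h4 (l : Dual ℂ (σ → ℂ)) : ConcentratedIn (contract φ (linearForm l)) 4 :=
    hφ.contract (d := 4) (k := 1) (isHomogeneous_linearForm l)
  by_cases hline : ∃ x ∈ K ⊓ LinearMap.ker m, eval x (C s' * q₁ + C t' * q₂) ≠ 0
  · obtain ⟨x, hx, hqx⟩ := hline
    have hzero : contract φ (linearForm n) = 0 :=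
      eq_zero_of_finrank_le_two_of_contract_eq_zero le_rfl (h4 n) (hb.contract _)
        ((hK.contract _).inf_ker (by rw [contract_mul, hnm])) (by omega) (hpencil s' t')
        (by rw [contract_comm, hcontract]; rfl) hx hqx
    exact eq_zero_of_finrank_le_two le_rfl hφ hb (hK.inf_ker hzero) (by omega)
  · push Not at hline
    obtain ⟨l, hl, hql⟩ := exists_eval_eq_mul (hpencil s' t') hy hmy hline
    obtain ⟨l, rfl⟩ := exists_eq_linearForm hl
    simp only [eval_linearForm] at hql
    have hml : contract φ (linearForm m * linearForm l) = 0 := by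
      rw [← hK.contract_congr (g := C s' * q₁ + C t' * q₂) fun x hx => by simp [← hql x hx],
        hcontract]
    obtain ⟨z, hz, hlz⟩ : ∃ z ∈ K ⊓ LinearMap.ker n, l z ≠ 0 := by
      by_contra! h
      have hl (x) (hx : x ∈ K) : l x = l e / n e * n x := by
        have := h (x - (n x / n e) • e)
          ⟨K.sub_mem hx (K.smul_mem _ he), by simp [hne]⟩
        rw [map_sub, map_smul, smul_eq_mul, sub_eq_zero] at this
        rw [this]; ring
      have h0 := hind (s' - l e / n e * s) (t' - l e / n e * t) fun x hx => by
        have e₁ := hqm x hx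
        have e₂ := hql x hx
        rw [hl x hx] at e₂
        simp only [map_add, map_mul, eval_C] at e₁ e₂ ⊢
        linear_combination e₂ - l e / n e * e₁
      exact hst' (by linear_combination s * h0.2 - t * h0.1)
    have hlt := finrank_inf_ker_lt hz hlz
    have hzero : contract φ (linearForm m) = 0 :=
      eq_zero_of_finrank_le_one (by norm_num) (h4 m) (hb.contract _)
        (((hK.contract _).inf_ker (by rw [contract_mul, mul_comm, hnm])).inf_ker
          (by rw [contract_mul, hml])) (by omega)
    exact eq_zero_of_finrank_le_two le_rfl hφ hb (hK.inf_ker hzero) (by omega)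

lemma finrank_homogeneousSubmodule (n : ℕ) :
    finrank ℂ (homogeneousSubmodule σ ℂ n) = (Fintype.card σ + n - 1).choose n := by
  classical
  rw [homogeneousSubmodule_eq_finsupp_supported]
  have h : {d : σ →₀ ℕ | d.degree = n} = ((Finset.univ : Finset σ).finsuppAntidiag n : Set _) := by
    ext d
    simp [Finset.mem_finsuppAntidiag, Finsupp.degree_eq_sum]
  rw [h, (AddMonoidAlgebra.supportedEquivFinsupp _).finrank_eq, Module.finrank_finsupp_self]
  simp [Finset.card_finsuppAntidiag_nat_eq_choose]

instance (n : ℕ) : Module.Finite ℂ (homogeneousSubmodule σ ℂ n) :=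
  Module.Finite.iff_fg.2 (homogeneousSubmodule_fg ..)

section Points

variable {ι : Type*} [Fintype ι] {c : ι → ℂ} {P : ι → σ → ℂ}

/-- If every relation among the evaluations at the points on forms of degree `k` persisted on
forms of degree `k + 1`, then there would be no nontrivial relation. -/
lemma eq_zero_of_forall_relation_succ (ℓ : Dual ℂ (σ → ℂ)) (hℓ : ∀ i, ℓ (P i) = 1)
    (hP : Function.Injective P) {k : ℕ}
    (hstep : ∀ c : ι → ℂ,
      (∀ g : MvPolynomial σ ℂ, g.IsHomogeneous k → ∑ i, c i * eval (P i) g = 0) →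
      ∀ g : MvPolynomial σ ℂ, g.IsHomogeneous (k + 1) → ∑ i, c i * eval (P i) g = 0)
    (hc : ∀ g : MvPolynomial σ ℂ, g.IsHomogeneous k → ∑ i, c i * eval (P i) g = 0) : c = 0 := by
  classical
  have hall (s : ℕ) (c : ι → ℂ)
      (hc : ∀ g : MvPolynomial σ ℂ, g.IsHomogeneous k → ∑ i, c i * eval (P i) g = 0)
      (g : MvPolynomial σ ℂ) (hg : g.IsHomogeneous (k + s)) : ∑ i, c i * eval (P i) g = 0 := by
    induction s generalizing c g with
    | zero => exact hc g hg
    | succ s ih =>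
      obtain ⟨p, hp, rfl⟩ := exists_sum_X_mul (k := k + s) hg
      simp only [map_sum, map_mul, eval_X, Finset.mul_sum]
      rw [Finset.sum_comm]
      refine Finset.sum_eq_zero fun j _ => ?_
      have h := ih (fun i => c i * P i j) (fun g hg => ?_) (p j) (hp j)
      · simpa [mul_assoc] using h
      · have h := hstep c hc (X j * g) (add_comm k 1 ▸ (isHomogeneous_X ℂ j).mul hg)
        simpa [mul_assoc] using h
  ext i₀
  have hsep (i : ι) : ∃ f : Dual ℂ (σ → ℂ), f (P i) = 0 ∧ (i ≠ i₀ → f (P i₀) ≠ 0) := by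
    by_cases hi : i = i₀
    · exact ⟨0, by simp, fun h => absurd hi h⟩
    · obtain ⟨j, hj⟩ := Function.ne_iff.1 (hP.ne hi)
      refine ⟨LinearMap.proj j - P i j • ℓ, by simp [hℓ], fun _ => ?_⟩
      simpa [hℓ, sub_eq_zero] using hj.symm
  choose f hf hf₀ using hsep
  set g := linearForm ℓ ^ k * ∏ i ∈ Finset.univ.erase i₀, linearForm (f i)
  have hg : g.IsHomogeneous (k + (Finset.univ.erase i₀).card) := by
    have h₁ := (isHomogeneous_linearForm ℓ).pow k
    have h₂ := IsHomogeneous.prod (Finset.univ.erase i₀) (fun i => linearForm (f i)) (fun _ => 1)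
      fun i _ => isHomogeneous_linearForm (f i)
    simpa using h₁.mul h₂
  have h := hall _ c hc g hg
  rw [Finset.sum_eq_single i₀] at h
  · refine (mul_eq_zero.1 h).resolve_right ?_
    simp only [g, map_mul, map_pow, map_prod, eval_linearForm, hℓ, one_pow, one_mul]
    exact Finset.prod_ne_zero_iff.2 fun i hi => hf₀ i (Finset.ne_of_mem_erase hi)
  · intro i _ hi
    simp only [g, map_mul, map_pow, map_prod, eval_linearForm]
    rw [Finset.prod_eq_zero (Finset.mem_erase.2 ⟨hi, Finset.mem_univ i⟩) (hf i), mul_zero,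
      mul_zero]
  · simp

/-- Two subspaces of `ℂ^ι` orthogonal for the standard bilinear form have complementary
dimensions at most. -/
lemma finrank_add_finrank_le_card {U W : Submodule ℂ (ι → ℂ)}
    (h : ∀ x ∈ U, ∀ y ∈ W, ∑ i, x i * y i = 0) :
    finrank ℂ U + finrank ℂ W ≤ Fintype.card ι := by
  classical
  have hle : U.map (dotProductEquiv ℂ ι).toLinearMap ≤ W.dualAnnihilator := by
    rintro _ ⟨x, hx, rfl⟩
    rw [Submodule.mem_dualAnnihilator]
    exact fun y hy => h x hx y hy
  have h₁ := Submodule.finrank_mono hle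
  rw [LinearEquiv.finrank_map_eq] at h₁
  have h₂ := Subspace.finrank_add_finrank_dualAnnihilator_eq W
  rw [Module.finrank_fintype_fun_eq_card] at h₂
  omega

/-- The coefficients of a relation on forms of degree `2 k` are supported on the zero locus of
many forms of degree `k`. -/
lemma finrank_le_finrank_ker_of_relation {k : ℕ}
    (hc : ∀ g : MvPolynomial σ ℂ, g.IsHomogeneous (k + k) → ∑ i, c i * eval (P i) g = 0) :
    2 * finrank ℂ (homogeneousSubmodule σ ℂ k) ≤ 2 * finrank ℂ (LinearMap.ker
      ((LinearMap.pi fun i => c i • (aeval (P i)).toLinearMap) ∘ₗ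
        (homogeneousSubmodule σ ℂ k).subtype)) + Fintype.card ι := by
  set E : homogeneousSubmodule σ ℂ k →ₗ[ℂ] ι → ℂ :=
    (LinearMap.pi fun i => (aeval (P i)).toLinearMap) ∘ₗ (homogeneousSubmodule σ ℂ k).subtype
  set T : homogeneousSubmodule σ ℂ k →ₗ[ℂ] ι → ℂ :=
    (LinearMap.pi fun i => c i • (aeval (P i)).toLinearMap) ∘ₗ
      (homogeneousSubmodule σ ℂ k).subtype
  have hTE : T = (LinearMap.pi fun i => c i • LinearMap.proj i) ∘ₗ E := by
    refine LinearMap.ext fun g => funext fun i => ?_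
    simp [T, E]
  have h₁ : finrank ℂ (LinearMap.range T) ≤ finrank ℂ (LinearMap.range E) := by
    rw [hTE, LinearMap.range_comp]
    exact Submodule.finrank_map_le _ _
  have h₂ : finrank ℂ (LinearMap.range T) + finrank ℂ (LinearMap.range E) ≤ Fintype.card ι := by
    refine finrank_add_finrank_le_card ?_
    rintro _ ⟨g, rfl⟩ _ ⟨h, rfl⟩
    simpa [T, E, aeval_eq_eval, mul_assoc] using hc _ (g.2.mul h.2)
  have h₃ := T.finrank_range_add_finrank_ker
  omega

/-- At most `17` points of projective three-space that are zeros of a base point free (away from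
the points) system of cubics impose independent conditions on quartics. -/
lemma eq_zero_of_relation_quartics (hσ : Fintype.card σ = 4) (hι : Fintype.card ι ≤ 17)
    (ℓ : Dual ℂ (σ → ℂ)) (hℓ : ∀ i, ℓ (P i) = 1) (hP : Function.Injective P)
    (hcubics : ∀ u : σ → ℂ, u ≠ 0 → ℓ u = 0 → ∃ g : MvPolynomial σ ℂ, g.IsHomogeneous 3 ∧
      (∀ i, eval (P i) g = 0) ∧ eval u g ≠ 0)
    (hc : ∀ g : MvPolynomial σ ℂ, g.IsHomogeneous 4 → ∑ i, c i * eval (P i) g = 0) : c = 0 := by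
  refine eq_zero_of_forall_relation_succ ℓ hℓ hP (fun c hc g hg => ?_) hc
  rw [← pointFunctional_apply hg]
  suffices h : pointFunctional c P 5 = 0 by rw [h, LinearMap.zero_apply]
  set φ := pointFunctional c P 5
  by_cases hc0 : ∃ i, c i ≠ 0
  swap
  · push Not at hc0
    exact concentratedIn_pointFunctional.eq_zero fun g hg => by
      rw [pointFunctional_apply hg]; simp [hc0]
  obtain ⟨i₀, hi₀⟩ := hc0
  have hφ : ConcentratedIn φ 5 := concentratedIn_pointFunctional
  have hφℓ : contract φ (linearForm ℓ) = 0 := by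
    have h := hφ.contract (d := 4) (k := 1) (isHomogeneous_linearForm ℓ)
    refine h.eq_zero fun m hm => ?_
    rw [contract_apply, pointFunctional_apply ((isHomogeneous_linearForm ℓ).mul hm)]
    simpa [hℓ] using hc m hm
  have hb : CubicsBasePointFree φ := fun u hu => by
    by_cases hu0 : ℓ u = 0
    · obtain ⟨g, hg, hgP, hgu⟩ := hcubics u hu hu0
      exact ⟨3, le_rfl, g, hg, contract_pointFunctional_eq_zero hg (by norm_num)
        fun i => by rw [hgP, mul_zero], hgu⟩
    · exact ⟨1, by norm_num, linearForm ℓ, isHomogeneous_linearForm ℓ, hφℓ, by simpa using hu0⟩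
  have hK : SupportedOn φ (⊤ ⊓ LinearMap.ker ℓ) := (supportedOn_top φ).inf_ker hφℓ
  have hP₀ : ℓ (P i₀) ≠ 0 := by simp [hℓ]
  have hr : finrank ℂ ↥(⊤ ⊓ LinearMap.ker ℓ) ≤ 3 := by
    have h := finrank_inf_ker_lt (Submodule.mem_top (x := P i₀)) hP₀
    rw [finrank_top, Module.finrank_fintype_fun_eq_card, hσ] at h
    omega
  have hker := finrank_le_finrank_ker_of_relation (k := 2) hc
  rw [finrank_homogeneousSubmodule, hσ, show Nat.choose (4 + 2 - 1) 2 = 10 from rfl] at hker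
  set N := LinearMap.ker ((LinearMap.pi fun i => c i • (aeval (P i)).toLinearMap) ∘ₗ
    (homogeneousSubmodule σ ℂ 2).subtype)
  have hN (q : N) (i : ι) : c i * eval (P i) q.1.1 = 0 := by
    rw [← aeval_eq_eval]
    exact congrFun (LinearMap.mem_ker.1 q.2) i
  have : Nontrivial N := Module.nontrivial_of_finrank_pos (R := ℂ) (by omega)
  obtain ⟨q₁, hq₁⟩ := exists_ne (0 : N)
  obtain ⟨q₂, hq⟩ := exists_linearIndependent_pair_of_one_lt_finrank (R := ℂ) (M := N)
    (by omega) hq₁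
  have hN0 (q : N) : contract φ q.1.1 = 0 :=
    contract_pointFunctional_eq_zero q.1.2 (by norm_num) (hN q)
  by_contra hφ0
  refine hφ0 (eq_zero_of_finrank_le_three hφ hb hK hr q₁.1.2 q₂.1.2 (hN0 q₁) (hN0 q₂)
    fun s t hst => ?_)
  have hval : C s * q₁.1.1 + C t * q₂.1.1 = (s • q₁ + t • q₂ : N).1.1 := by
    simp [smul_eq_C_mul]
  rw [hval] at hst
  set q := s • q₁ + t • q₂
  refine LinearIndependent.pair_iff.1 hq s t ?_
  obtain ⟨l, hl, hql⟩ := exists_eval_eq_mul (k := 1) q.1.2 Submodule.mem_top hP₀ hst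
  obtain ⟨l, rfl⟩ := exists_eq_linearForm hl
  simp only [eval_linearForm] at hql
  have hcl (i : ι) : c i * l (P i) = 0 := by
    have h := hN q i
    rwa [hql _ trivial, hℓ, one_mul] at h
  have hφl : contract φ (linearForm l) = 0 :=
    contract_pointFunctional_eq_zero hl (by norm_num) fun i => by rw [eval_linearForm, hcl]
  have hlK : ∀ x, ℓ x = 0 → l x = 0 := by
    by_contra! h
    obtain ⟨x, hx, hlx⟩ := h
    have hlt := finrank_inf_ker_lt (K := ⊤ ⊓ LinearMap.ker ℓ) ⟨Submodule.mem_top, hx⟩ hlx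
    exact hφ0 (eq_zero_of_finrank_le_two le_rfl hφ hb (hK.inf_ker hφl) (by omega))
  have hl0 (x : σ → ℂ) : l x = 0 := by
    have h := hlK (x - ℓ x • P i₀) (by simp [hℓ])
    rwa [map_sub, map_smul, (mul_eq_zero.1 (hcl i₀)).resolve_left hi₀, smul_zero, sub_zero] at h
  refine Subtype.ext (Subtype.ext (MvPolynomial.funext fun x => ?_))
  rw [hql x trivial, hl0, mul_zero]
  simp

end Points

end NodalQuartic

/-- Let `f` be an irreducible homogeneous quartic form on `ℙ³` (in 4 variables,
over `ℂ`) whose singular locus consists exactly of `δ` nodes (`1 ≤ δ ≤ 16`), represented by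
pairwise non-proportional nonzero affine representatives `Δ`; a node is a singular point at
which the Hessian matrix of `f` has rank `3`.  Then the space of quartic forms vanishing at
all the nodes has dimension `35 − δ`: the nodes impose independent conditions on the
`35`-dimensional space `H⁰(O_{ℙ³}(4))`. -/
theorem nodes_impose_independent_conditions_on_quartics
    (f : MvPolynomial (Fin 4) ℂ) (hf4 : f.IsHomogeneous 4) (hirr : Irreducible f)
    (Δ : Finset (Fin 4 → ℂ)) (δ : ℕ) (hδ : δ = Δ.card) (hδ1 : 1 ≤ δ) (hδ16 : δ ≤ 16)
    (hne : ∀ p ∈ Δ, p ≠ 0)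
    (hdistinct : ∀ p ∈ Δ, ∀ q ∈ Δ, (∃ c : ℂ, c • p = q) → p = q)
    -- every point of `Δ` lies on the quartic and is a singular point of it:
    (hsing : ∀ p ∈ Δ, eval p f = 0 ∧ ∀ i : Fin 4, eval p (pderiv i f) = 0)
    -- every point of `Δ` is an ordinary double point (the Hessian has rank 3):
    (hnode : ∀ p ∈ Δ,
      (Matrix.of fun i j : Fin 4 => eval p (pderiv i (pderiv j f))).rank = 3)
    -- the singular locus of the quartic is exactly the (punctured) cone over `Δ`:
    (hsingloc : ∀ x : Fin 4 → ℂ, x ≠ 0 →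
      ((∀ i : Fin 4, eval x (pderiv i f) = 0) ↔ ∃ p ∈ Δ, ∃ c : ℂ, c • p = x)) :
    finrank ℂ
      ((homogeneousSubmodule (Fin 4) ℂ 4 ⊓
          ⨅ p ∈ Δ, LinearMap.ker ((aeval p : MvPolynomial (Fin 4) ℂ →ₐ[ℂ] ℂ).toLinearMap))
        : Submodule ℂ (MvPolynomial (Fin 4) ℂ))
      = 35 - δ := by
  classical
  obtain ⟨ℓ, hℓ⟩ := Module.exists_dual_forall_apply_ne_zero (K := ℂ)
    (fun p : Δ => (p : Fin 4 → ℂ)) fun p => hne p p.2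
  set P : Δ → Fin 4 → ℂ := fun p => (ℓ p)⁻¹ • (p : Fin 4 → ℂ)
  have hℓP (p : Δ) : ℓ (P p) = 1 := by simp [P, hℓ p]
  have hP : Function.Injective P := fun p q hpq => by
    refine Subtype.ext (hdistinct p p.2 q q.2 ⟨ℓ q * (ℓ p)⁻¹, ?_⟩)
    rw [mul_smul, show (ℓ p)⁻¹ • (p : Fin 4 → ℂ) = (ℓ q)⁻¹ • (q : Fin 4 → ℂ) from hpq,
      smul_inv_smul₀ (hℓ q)]
  have hcubics (u : Fin 4 → ℂ) (hu : u ≠ 0) (hℓu : ℓ u = 0) :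
      ∃ g : MvPolynomial (Fin 4) ℂ, g.IsHomogeneous 3 ∧ (∀ i, eval (P i) g = 0) ∧
        eval u g ≠ 0 := by
    by_contra! h
    have hhom (i : Fin 4) : (pderiv i f).IsHomogeneous 3 := hf4.pderiv
    obtain ⟨p, hp, c, rfl⟩ := (hsingloc u hu).1 fun i => h _ (hhom i) fun p => by
      rw [NodalQuartic.eval_smul (hhom i), (hsing p p.2).2 i, mul_zero]
    rw [map_smul, smul_eq_mul] at hℓu
    rw [(mul_eq_zero.1 hℓu).resolve_right (hℓ ⟨p, hp⟩), zero_smul] at hu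
    exact hu rfl
  set EV : homogeneousSubmodule (Fin 4) ℂ 4 →ₗ[ℂ] Δ → ℂ :=
    (LinearMap.pi fun p : Δ => (aeval p.1).toLinearMap) ∘ₗ
      (homogeneousSubmodule (Fin 4) ℂ 4).subtype
  have hrange : LinearMap.range EV = ⊤ := by
    by_contra h
    obtain ⟨θ, hθ, hle⟩ := Submodule.exists_le_ker_of_lt_top _ (lt_top_iff_ne_top.2 h)
    have hθv (v : Δ → ℂ) : θ v = ∑ p, θ (Pi.single p 1) * v p := by
      conv_lhs => rw [← (Pi.basisFun ℂ Δ).sum_repr v, map_sum]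
      simp [mul_comm]
    have hc : (fun p : Δ => θ (Pi.single p 1) * ℓ p ^ 4) = 0 := by
      refine NodalQuartic.eq_zero_of_relation_quartics (by simp) (by simp; omega) ℓ hℓP hP hcubics
        fun g hg => ?_
      have h := hle (LinearMap.mem_range_self EV ⟨g, hg⟩)
      rw [LinearMap.mem_ker, hθv] at h
      rw [← h]
      refine Finset.sum_congr rfl fun p _ => ?_
      rw [NodalQuartic.eval_smul hg, mul_assoc, ← mul_assoc (ℓ p ^ 4), ← mul_pow,
        mul_inv_cancel₀ (hℓ p), one_pow, one_mul]
      simp [EV, aeval_eq_eval]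
    refine hθ (LinearMap.ext fun v => ?_)
    rw [hθv]
    exact Finset.sum_eq_zero fun p _ => by
      rw [(mul_eq_zero.1 (congrFun hc p)).resolve_right (pow_ne_zero 4 (hℓ p)), zero_mul]
  have hker : homogeneousSubmodule (Fin 4) ℂ 4 ⊓
      ⨅ p ∈ Δ, LinearMap.ker ((aeval p : MvPolynomial (Fin 4) ℂ →ₐ[ℂ] ℂ).toLinearMap) =
      (LinearMap.ker EV).map (homogeneousSubmodule (Fin 4) ℂ 4).subtype := by
    ext g
    simp [EV, funext_iff, Submodule.mem_iInf, and_comm]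
  have hsum := EV.finrank_range_add_finrank_ker
  rw [hrange, finrank_top, Module.finrank_fintype_fun_eq_card, Fintype.card_coe,
    NodalQuartic.finrank_homogeneousSubmodule, Fintype.card_fin,
    show Nat.choose (4 + 4 - 1) 4 = 35 from rfl] at hsum
  rw [hker, Submodule.finrank_map_subtype_eq]
  omega
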